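/- arXiv:2310.17349 — 2 statements merged into one kernel-verified Lean document; each statement's English description precedes it below -/
import Mathlib

section
/- Let 𝒜 be an abelian category and consider a pushout square in the category of ℤ-indexed chain complexes over 𝒜, with parallel morphisms f : A → B and g : X → Y (g the pushout of f along a morphism A → X). If f is both a monomorphism and a quasi-isomorphism, then g is a quasi-isomorphism. -/
/-!
Statement 7: In the category of `ℤ`-indexed chain complexes over an abelian category `𝒜`,
consider a pushout square with parallel morphisms `f : A ⟶ B` and `g : X ⟶ Y` (where `g` is
the pushout of `f` along a morphism `A ⟶ X`). If `f` is both a monomorphism and a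
quasi-isomorphism, then `g` is a quasi-isomorphism.
-/

open CategoryTheory Limits

universe v u

theorem quasiIso_of_isPushout_of_mono
    {𝒜 : Type u} [Category.{v} 𝒜] [Abelian 𝒜]
    {A B X Y : HomologicalComplex 𝒜 (ComplexShape.down ℤ)}
    (f : A ⟶ B) (i : A ⟶ X) (i' : B ⟶ Y) (g : X ⟶ Y)
    (sq : IsPushout f i i' g)
    (hmono : Mono f) (hq : QuasiIso f) :
    QuasiIso g := by
  have hg : Mono g :=
    (MorphismProperty.monomorphisms _).of_isPushout sq.flip
      ((MorphismProperty.monomorphisms.iff f).2 hmono)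
  have hS : (ShortComplex.mk f (cokernel.π f) (cokernel.condition f)).ShortExact :=
    { exact := ShortComplex.exact_cokernel f
      mono_f := hmono
      epi_g := inferInstanceAs (Epi (cokernel.π f)) }
  have hT : (ShortComplex.mk g (cokernel.π g) (cokernel.condition g)).ShortExact :=
    { exact := ShortComplex.exact_cokernel g
      mono_f := hg
      epi_g := inferInstanceAs (Epi (cokernel.π g)) }
  have hacyc := hS.acyclic_X₃ hq
  have hiso := isIso_cokernel_map_of_isPushout sq
  have hzero : ∀ n, IsZero ((cokernel g).homology n) := fun n =>
    ((hacyc n).of_iso (asIso (cokernel.map _ _ _ _ sq.w))).isZero_homology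
  rw [quasiIso_iff]
  intro n
  rw [quasiIsoAt_iff_isIso_homologyMap]
  have h1 : Mono (HomologicalComplex.homologyMap g n) :=
    (hT.homology_exact₁ (n + 1) n (by simp)).mono_g ((hzero (n + 1)).eq_of_src _ _)
  have h2 : Epi (HomologicalComplex.homologyMap g n) :=
    (hT.homology_exact₂ n).epi_f ((hzero n).eq_of_tgt _ _)
  exact isIso_of_mono_of_epi _
end

section
/- Let 𝒜 be an abelian category, f : A → B a quasi-isomorphism of ℤ-indexed chain complexes over 𝒜, and i : A → C a morphism of chain complexes which is a (degreewise) monomorphism. Then the pushout C → B ⊔_A C of f along i is a quasi-isomorphism. In other words, quasi-isomorphisms of chain complexes over an abelian category are stable under pushout along degreewise monomorphisms. -/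
/-!
Statement 8: In the category of `ℤ`-indexed chain complexes over an abelian category `𝒜`,
quasi-isomorphisms are stable under pushout along degreewise monomorphisms: if `f : A ⟶ B`
is a quasi-isomorphism and `i : A ⟶ C` is a monomorphism (equivalently, a degreewise
monomorphism), then the pushout `C ⟶ B ⊔_A C` of `f` along `i` is a quasi-isomorphism.
-/

open CategoryTheory Limits

universe v u

/-- The direct sum of a quasi-isomorphism with an identity is a quasi-isomorphism. -/
theorem quasiIso_biprod_map_id
    {𝒜 : Type u} [Category.{v} 𝒜] [Abelian 𝒜]
    {A B : HomologicalComplex 𝒜 (ComplexShape.down ℤ)}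
    (f : A ⟶ B) (hf : QuasiIso f) (C : HomologicalComplex 𝒜 (ComplexShape.down ℤ)) :
    QuasiIso (biprod.map f (𝟙 C)) := by
  rw [quasiIso_iff]
  intro n
  rw [quasiIsoAt_iff_isIso_homologyMap]
  let F := HomologicalComplex.homologyFunctor 𝒜 (ComplexShape.down ℤ) n
  have hF : IsIso (F.map f) := inferInstanceAs (IsIso (HomologicalComplex.homologyMap f n))
  change IsIso (F.map (biprod.map f (𝟙 C)))
  refine ⟨F.map biprod.fst ≫ inv (F.map f) ≫ F.map biprod.inl +
    F.map biprod.snd ≫ F.map biprod.inr, ?_, ?_⟩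
  · rw [Preadditive.comp_add, ← F.map_comp_assoc, ← F.map_comp_assoc, biprod.map_fst,
      biprod.map_snd, F.map_comp, Category.assoc, IsIso.hom_inv_id_assoc, Category.comp_id,
      ← F.map_comp, ← F.map_comp, ← F.map_add, biprod.total, F.map_id]
  · rw [Preadditive.add_comp, Category.assoc, Category.assoc, Category.assoc,
      ← F.map_comp, ← F.map_comp, biprod.inl_map, biprod.inr_map, F.map_comp,
      IsIso.inv_hom_id_assoc, Category.id_comp,
      ← F.map_comp, ← F.map_comp, ← F.map_add, biprod.total, F.map_id]

/-- A pushout square along a monomorphism gives a short exact sequence. -/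
theorem shortExact_of_isPushout_of_mono
    {𝒞 : Type u} [Category.{v} 𝒞] [Abelian 𝒞] {A B C P : 𝒞}
    {f : A ⟶ B} {i : A ⟶ C} {l : B ⟶ P} {r : C ⟶ P} (h : IsPushout f i l r) [Mono i] :
    h.shortComplex.ShortExact where
  exact := h.exact_shortComplex
  mono_f := by
    change Mono (biprod.lift f (-i))
    have : Mono (biprod.lift f (-i) ≫ biprod.snd) := by
      rw [biprod.lift_snd]
      infer_instance
    exact mono_of_mono _ biprod.snd
  epi_g := h.epi_shortComplex_g

theorem quasiIso_pushout_inr_of_mono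
    {𝒜 : Type u} [Category.{v} 𝒜] [Abelian 𝒜]
    {A B C : HomologicalComplex 𝒜 (ComplexShape.down ℤ)}
    (f : A ⟶ B) (i : A ⟶ C) (hf : QuasiIso f) (hi : Mono i) :
    QuasiIso (pushout.inr f i) := by
  have h₁ : IsPushout (𝟙 A) i i (𝟙 C) := IsPushout.of_horiz_isIso ⟨by simp⟩
  have h₂ := IsPushout.of_hasPushout f i
  let φ : h₁.shortComplex ⟶ h₂.shortComplex :=
    { τ₁ := 𝟙 A
      τ₂ := biprod.map f (𝟙 C)
      τ₃ := pushout.inr f i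
      comm₁₂ := by
        change 𝟙 A ≫ biprod.lift f (-i) = biprod.lift (𝟙 A) (-i) ≫ biprod.map f (𝟙 C)
        apply biprod.hom_ext <;> simp
      comm₂₃ := by
        change biprod.map f (𝟙 C) ≫ biprod.desc (pushout.inl f i) (pushout.inr f i) =
          biprod.desc i (𝟙 C) ≫ pushout.inr f i
        apply biprod.hom_ext' <;> simp [pushout.condition] }
  exact HomologicalComplex.HomologySequence.quasiIso_τ₃ φ
    (shortExact_of_isPushout_of_mono h₁) (shortExact_of_isPushout_of_mono h₂)
    (inferInstanceAs (QuasiIso (𝟙 A))) (quasiIso_biprod_map_id f hf C)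
end
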